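/- arXiv:1212.4192 — 4 statements merged into one kernel-verified Lean document; each statement's English description precedes it below -/
import Mathlib

section
/- Let G be a finitely generated group and let H be a subgroup of G of finite index. Then rk(H) ≤ [G:H]·(rk(G) − 1) + 1 ≤ [G:H]·rk(G), where rk denotes the rank (minimal number of generators) of a finitely generated group. -/
open scoped Finset

namespace MulAction

variable {G Ω : Type*} [Group G] [MulAction G Ω]

/-- A set stable under a generating set, in the sense that membership is preserved and reflected,
is everything as soon as the action is transitive and the set is nonempty. -/
theorem mem_of_smul_mem_iff [IsPretransitive G Ω] {S : Set G} (hS : Subgroup.closure S = ⊤)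
    {A : Set Ω} {x₀ : Ω} (hx₀ : x₀ ∈ A) (hA : ∀ s ∈ S, ∀ x, s • x ∈ A ↔ x ∈ A) (x : Ω) :
    x ∈ A := by
  have key : ∀ g : G, ∀ y, g • y ∈ A ↔ y ∈ A := by
    intro g
    have hg : g ∈ Subgroup.closure S := hS ▸ Subgroup.mem_top g
    induction hg using Subgroup.closure_induction with
    | mem s hs => exact hA s hs
    | one => simp
    | mul a b _ _ ha hb => intro y; rw [mul_smul, ha, hb]
    | inv a _ ha => intro y; rw [← ha, smul_inv_smul]
  obtain ⟨g, rfl⟩ := exists_smul_eq G x₀ x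
  exact (key g x₀).2 hx₀

/-- For every size `k + 1` not exceeding that of `Ω`, the Schreier graph has a subtree with `k + 1`
vertices `A` and `k` edges `E`, together with a section `t` of the orbit map over `A` that is
compatible with the edges. -/
theorem exists_schreier_subtree [Finite Ω] [IsPretransitive G Ω] {S : Finset G}
    (hS : Subgroup.closure (S : Set G) = ⊤) (x₀ : Ω) (k : ℕ) (hk : k + 1 ≤ Nat.card Ω) :
    ∃ (A : Finset Ω) (t : Ω → G) (E : Finset (G × Ω)), #A = k + 1 ∧ #E = k ∧ x₀ ∈ A ∧ t x₀ = 1 ∧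
      (∀ x ∈ A, t x • x₀ = x) ∧
      ∀ e ∈ E, e.1 ∈ S ∧ e.2 ∈ A ∧ e.1 • e.2 ∈ A ∧ t (e.1 • e.2) = e.1 * t e.2 := by
  classical
  induction k with
  | zero => exact ⟨{x₀}, fun _ => 1, ∅, by simp⟩
  | succ k ih =>
    obtain ⟨A, t, E, hA, hE, hx₀, ht₀, ht, htE⟩ := ih (by omega)
    have hboundary : ∃ s ∈ S, ∃ x, ¬(s • x ∈ A ↔ x ∈ A) := by
      by_contra! h
      have huniv : ∀ x, x ∈ A := mem_of_smul_mem_iff (A := (A : Set Ω)) hS hx₀ h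
      have := Fintype.ofFinite Ω
      rw [Finset.eq_univ_iff_forall.2 huniv, Finset.card_univ, ← Nat.card_eq_fintype_card] at hA
      omega
    have extend : ∀ (y : Ω) (g : G) (e : G × Ω), y ∉ A → g • x₀ = y → e.1 ∈ S →
        ¬(e.2 ∈ A ∧ e.1 • e.2 ∈ A) → e.2 ∈ insert y A → e.1 • e.2 ∈ insert y A →
        Function.update t y g (e.1 • e.2) = e.1 * Function.update t y g e.2 →
        ∃ (A : Finset Ω) (t : Ω → G) (E : Finset (G × Ω)), #A = k + 1 + 1 ∧ #E = k + 1 ∧ x₀ ∈ A ∧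
          t x₀ = 1 ∧ (∀ x ∈ A, t x • x₀ = x) ∧
          ∀ e ∈ E, e.1 ∈ S ∧ e.2 ∈ A ∧ e.1 • e.2 ∈ A ∧ t (e.1 • e.2) = e.1 * t e.2 := by
      intro y g e hy hg heS heA he₁ he₂ het
      have hne : ∀ {x}, x ∈ A → x ≠ y := fun hx h => hy (h ▸ hx)
      refine ⟨insert y A, Function.update t y g, insert e E, ?_, ?_,
        Finset.mem_insert_of_mem hx₀, ?_, ?_, ?_⟩
      · rw [Finset.card_insert_of_notMem hy, hA]
      · rw [Finset.card_insert_of_notMem fun h => heA ⟨(htE e h).2.1, (htE e h).2.2.1⟩, hE]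
      · rw [Function.update_of_ne (hne hx₀), ht₀]
      · intro x hx
        rcases Finset.mem_insert.1 hx with rfl | hx
        · rw [Function.update_self, hg]
        · rw [Function.update_of_ne (hne hx), ht x hx]
      · intro f hf
        rcases Finset.mem_insert.1 hf with rfl | hf
        · exact ⟨heS, he₁, he₂, het⟩
        · obtain ⟨h₁, h₂, h₃, h₄⟩ := htE f hf
          refine ⟨h₁, Finset.mem_insert_of_mem h₂, Finset.mem_insert_of_mem h₃, ?_⟩
          rw [Function.update_of_ne (hne h₂), Function.update_of_ne (hne h₃), h₄]
    obtain ⟨s, hs, x, hsx⟩ := hboundary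
    by_cases hx : x ∈ A
    · have hy : s • x ∉ A := fun h => hsx (iff_of_true h hx)
      have hne : x ≠ s • x := fun h => hy (h ▸ hx)
      refine extend (s • x) (s * t x) (s, x) hy (by rw [mul_smul, ht x hx]) hs
        (fun h => hy h.2) (Finset.mem_insert_of_mem hx) (Finset.mem_insert_self _ _) ?_
      simp [Function.update_of_ne hne]
    · have hy : s • x ∈ A := by
        by_contra h
        exact hsx (iff_of_false h hx)
      have hne : s • x ≠ x := fun h => hx (h ▸ hy)
      refine extend x (s⁻¹ * t (s • x)) (s, x) hx (by rw [mul_smul, ht _ hy, inv_smul_smul]) hs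
        (fun h => hx h.1) (Finset.mem_insert_self _ _) (Finset.mem_insert_of_mem hy) ?_
      simp [Function.update_of_ne hne]

/-- Schreier's lemma for stabilizers: if `t` is a section of the orbit map and `K` contains the
Schreier generators, then `K` contains the stabilizer. -/
theorem stabilizer_le_of_schreier_mem {S : Set G} (hS : Subgroup.closure S = ⊤) {x₀ : Ω}
    {t : Ω → G} (ht₀ : t x₀ = 1) {K : Subgroup G}
    (hK : ∀ s ∈ S, ∀ x, (t (s • x))⁻¹ * s * t x ∈ K) : stabilizer G x₀ ≤ K := by
  have key : ∀ g : G, ∀ x, (t (g • x))⁻¹ * g * t x ∈ K := by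
    intro g
    have hg : g ∈ Subgroup.closure S := hS ▸ Subgroup.mem_top g
    induction hg using Subgroup.closure_induction with
    | mem s hs => exact hK s hs
    | one => simp
    | mul a b _ _ ha hb =>
      intro x
      simpa [mul_smul, mul_assoc] using K.mul_mem (ha (b • x)) (hb x)
    | inv a _ ha =>
      intro x
      simpa [mul_assoc] using K.inv_mem (ha (a⁻¹ • x))
  intro g hg
  simpa [mem_stabilizer_iff.1 hg, ht₀] using key g x₀

/-- A point stabilizer of a transitive action on a finite set is generated by the Schreier
generators attached to the edges outside a spanning tree of the Schreier graph. -/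
theorem exists_finset_closure_eq_stabilizer [Finite Ω] [IsPretransitive G Ω] {S : Finset G}
    (hS : Subgroup.closure (S : Set G) = ⊤) (x₀ : Ω) :
    ∃ T : Finset G, #T + Nat.card Ω ≤ Nat.card Ω * #S + 1 ∧
      Subgroup.closure (T : Set G) = stabilizer G x₀ := by
  classical
  have := Fintype.ofFinite Ω
  have hpos : 0 < Nat.card Ω := Nat.card_pos_iff.2 ⟨⟨x₀⟩, inferInstance⟩
  obtain ⟨A, t, E, hA, hE, -, ht₀, ht, htE⟩ :=
    exists_schreier_subtree hS x₀ (Nat.card Ω - 1) (by omega)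
  have hAuniv : A = Finset.univ := by
    rw [← Finset.card_eq_iff_eq_univ, hA, ← Nat.card_eq_fintype_card]
    omega
  replace ht : ∀ x, t x • x₀ = x := fun x => ht x (hAuniv ▸ Finset.mem_univ x)
  have hsub : E ⊆ S ×ˢ Finset.univ := fun e he => by simp [(htE e he).1]
  let T : Finset G := ((S ×ˢ Finset.univ) \ E).image fun e => (t (e.1 • e.2))⁻¹ * e.1 * t e.2
  refine ⟨T, ?_, le_antisymm ?_ ?_⟩
  · have hT : #T ≤ #((S ×ˢ (Finset.univ : Finset Ω)) \ E) := Finset.card_image_le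
    have hle := Finset.card_le_card hsub
    rw [Finset.card_sdiff_of_subset hsub] at hT
    rw [Finset.card_product, Finset.card_univ, ← Nat.card_eq_fintype_card, mul_comm] at hT hle
    omega
  · rw [Subgroup.closure_le]
    intro g hg
    obtain ⟨e, -, rfl⟩ := Finset.mem_image.1 (Finset.mem_coe.1 hg)
    rw [SetLike.mem_coe, mem_stabilizer_iff, mul_smul, mul_smul, ht, inv_smul_eq_iff, ht]
  · refine stabilizer_le_of_schreier_mem hS ht₀ fun s hs x => ?_
    by_cases he : (s, x) ∈ E
    · have h : t (s • x) = s * t x := (htE _ he).2.2.2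
      rw [h, mul_assoc, inv_mul_cancel]
      exact one_mem _
    · refine Subgroup.subset_closure (Finset.mem_coe.2 (Finset.mem_image.2 ⟨(s, x), ?_, rfl⟩))
      simpa [he] using hs

end MulAction


/-- Let `G` be a finitely generated group and `H` a finite-index subgroup of `G`
(hence finitely generated, so that its rank is defined).  Then
`rk(H) ≤ [G:H]·(rk(G) − 1) + 1 ≤ [G:H]·rk(G)`. -/
theorem rank_le_index_mul_rank_sub_one_add_one
    {G : Type*} [Group G] [Group.FG G] (H : Subgroup G) [H.FiniteIndex] :
    (Group.rank H : ℤ) ≤ (H.index : ℤ) * ((Group.rank G : ℤ) - 1) + 1 ∧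
      (H.index : ℤ) * ((Group.rank G : ℤ) - 1) + 1 ≤ (H.index : ℤ) * (Group.rank G : ℤ) := by
  obtain ⟨S, hScard, hS⟩ := Group.rank_spec G
  obtain ⟨T, hTcard, hT⟩ :=
    MulAction.exists_finset_closure_eq_stabilizer hS ((1 : G) : G ⧸ H)
  rw [MulAction.stabilizer_quotient] at hT
  have hrank : Group.rank H ≤ #T :=
    (Subgroup.rank_congr hT).symm.trans_le (Subgroup.rank_closure_finset_le_card T)
  change #T + H.index ≤ H.index * #S + 1 at hTcard
  rw [hScard] at hTcard
  have hindex : 0 < H.index := Nat.pos_of_ne_zero Subgroup.FiniteIndex.index_ne_zero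
  zify at hrank hTcard hindex
  constructor <;> linarith
end

section
/- Let π be a finitely generated group, let φ: π → ℤ be a group homomorphism, and let Γ ⊆ π be a subgroup of finite index. Then rg(Γ, φ|_Γ) ≤ [π:Γ]·rg(π, φ), where φ|_Γ denotes the restriction of φ to Γ. -/
/-- The rank of a group: the minimal number of elements of a (finite) generating set.
(By convention `sInf ∅ = 0` for groups that are not finitely generated.) -/
noncomputable def rk (G : Type*) [Group G] : ℕ :=
  sInf {n : ℕ | ∃ S : Finset G, S.card = n ∧ Subgroup.closure (S : Set G) = ⊤}

/-- `modKer φ n` is the subgroup `π_n`, the kernel of `φ : π → ℤ` followed by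
reduction modulo `n`. -/
def modKer {π : Type*} [Group π] (φ : π →* Multiplicative ℤ) (n : ℕ) : Subgroup π :=
  ((AddMonoidHom.toMultiplicative (Int.castAddHom (ZMod n))).comp φ).ker

/-- The rank gradient of `(π, φ)` : the limit inferior of `rk(π_n)/n`. -/
noncomputable def rankGradient {π : Type*} [Group π] (φ : π →* Multiplicative ℤ) : ℝ :=
  Filter.atTop.liminf fun n : ℕ => (rk ↥(modKer φ n) : ℝ) / n


theorem rk_eq_rank (G : Type*) [Group G] [Group.FG G] : rk G = Group.rank G := by
  obtain ⟨S, hS, hS'⟩ := Group.rank_spec G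
  refine le_antisymm (Nat.sInf_le ⟨S, hS, hS'⟩) (le_csInf ⟨_, S, hS, hS'⟩ ?_)
  rintro _ ⟨T, rfl, hT⟩
  exact Group.rank_le hT

theorem rk_congr {G H : Type*} [Group G] [Group H] [Group.FG G] (e : G ≃* H) : rk G = rk H := by
  have : Group.FG H := Group.fg_of_surjective (f := e.toMonoidHom) e.surjective
  rw [rk_eq_rank, rk_eq_rank, Group.rank_congr e]

theorem rk_le_index_mul_rk {G : Type*} [Group G] [Group.FG G] (H : Subgroup G) [H.FiniteIndex] :
    rk H ≤ H.index * rk G := by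
  rw [rk_eq_rank, rk_eq_rank]
  exact Subgroup.rank_le_index_mul_rank H

theorem modKer_index_dvd {π : Type*} [Group π] (φ : π →* Multiplicative ℤ) (n : ℕ) :
    (modKer φ n).index ∣ n := by
  have h : Nat.card (Multiplicative (ZMod n)) = n := Nat.card_zmod n
  rw [modKer, Subgroup.index_ker]
  exact (Subgroup.card_subgroup_dvd_card _).trans h.dvd

theorem modKer_finiteIndex {π : Type*} [Group π] (φ : π →* Multiplicative ℤ) {n : ℕ}
    (hn : n ≠ 0) : (modKer φ n).FiniteIndex :=
  ⟨ne_zero_of_dvd_ne_zero hn (modKer_index_dvd φ n)⟩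

/-- Both sides are the intersection `Γ ∩ π_n`, seen inside `π_n` and inside `Γ`. -/
def subgroupOfModKerEquiv {π : Type*} [Group π] (φ : π →* Multiplicative ℤ) (Γ : Subgroup π)
    (n : ℕ) : Γ.subgroupOf (modKer φ n) ≃* modKer (φ.comp Γ.subtype) n where
  toFun x := ⟨⟨x.1.1, x.2⟩, x.1.2⟩
  invFun x := ⟨⟨x.1.1, x.2⟩, x.1.2⟩
  left_inv _ := rfl
  right_inv _ := rfl
  map_mul' _ _ := rfl

theorem rk_modKer_le {π : Type*} [Group π] [Group.FG π] (φ : π →* Multiplicative ℤ) {n : ℕ}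
    (hn : n ≠ 0) : rk (modKer φ n) ≤ n * rk π := by
  have := modKer_finiteIndex φ hn
  exact (rk_le_index_mul_rk _).trans
    (Nat.mul_le_mul_right _ (Nat.le_of_dvd (Nat.pos_of_ne_zero hn) (modKer_index_dvd φ n)))

theorem rk_modKer_subgroup_le {π : Type*} [Group π] [Group.FG π] (φ : π →* Multiplicative ℤ)
    (Γ : Subgroup π) [Γ.FiniteIndex] {n : ℕ} (hn : n ≠ 0) :
    rk (modKer (φ.comp Γ.subtype) n) ≤ Γ.index * rk (modKer φ n) := by
  have := modKer_finiteIndex φ hn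
  rw [← rk_congr (subgroupOfModKerEquiv φ Γ n)]
  refine (rk_le_index_mul_rk _).trans (Nat.mul_le_mul_right _ ?_)
  have h : Γ.relIndex ⊤ ≠ 0 := Γ.relIndex_top_right ▸ Subgroup.FiniteIndex.index_ne_zero
  exact (Subgroup.relIndex_le_of_le_right le_top h).trans Γ.relIndex_top_right.le

/-- If `Γ ⊆ π` has finite index, then `rg(Γ, φ|_Γ) ≤ [π:Γ]·rg(π, φ)`. -/
theorem rankGradient_subgroup_le_index_mul
    {π : Type*} [Group π] [Group.FG π] (φ : π →* Multiplicative ℤ)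
    (Γ : Subgroup π) [Γ.FiniteIndex] :
    rankGradient (φ.comp Γ.subtype) ≤ (Γ.index : ℝ) * rankGradient φ := by
  have hbelow {G : Type _} [Group G] (ψ : G →* Multiplicative ℤ) :
      Filter.atTop.IsBoundedUnder (· ≥ ·) fun n : ℕ => (rk (modKer ψ n) : ℝ) / n :=
    Filter.isBoundedUnder_of ⟨0, fun n => by positivity⟩
  have habove : Filter.atTop.IsBoundedUnder (· ≤ ·) fun n : ℕ => (rk (modKer φ n) : ℝ) / n := by
    refine Filter.isBoundedUnder_of_eventually_le (a := (rk π : ℝ)) ?_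
    filter_upwards [Filter.eventually_ne_atTop 0] with n hn
    rw [div_le_iff₀ (by positivity), mul_comm]
    exact_mod_cast rk_modKer_le φ hn
  have hmono : Monotone fun x : ℝ => (Γ.index : ℝ) * x := fun _ _ h => by
    dsimp only; gcongr
  have hmul : (Γ.index : ℝ) * rankGradient φ =
      Filter.atTop.liminf fun n : ℕ => (Γ.index : ℝ) * ((rk (modKer φ n) : ℝ) / n) :=
    hmono.map_liminf_of_continuousAt _ (by fun_prop) habove.isCoboundedUnder_ge (hbelow φ)
  rw [hmul]
  refine Filter.liminf_le_liminf ?_ (hbelow _)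
    (hmono.isBoundedUnder_le_comp habove).isCoboundedUnder_ge
  filter_upwards [Filter.eventually_ne_atTop 0] with n hn
  rw [← mul_div_assoc]
  gcongr
  exact_mod_cast rk_modKer_subgroup_le φ Γ hn
end

section
/- Let π be a finitely generated group and let φ: π → ℤ be a surjective group homomorphism. If ker(φ) is generated by k elements, then for every positive integer n the subgroup π_n := ker(π → ℤ → ℤ/n) satisfies rk(π_n) ≤ k + 1; in particular rg(π, φ) = 0. -/
/-- A subgroup generated by a finite set has rank at most the cardinality of that set. -/
lemma rk_le_card_of_closure_eq {G : Type*} [Group G] {H : Subgroup G} (T : Finset G)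
    (hT : Subgroup.closure (T : Set G) = H) : rk H ≤ T.card := by
  subst hT
  obtain ⟨U, hcard, hU⟩ := Group.rank_spec (Subgroup.closure (T : Set G))
  calc rk (Subgroup.closure (T : Set G)) ≤ U.card := Nat.sInf_le ⟨U, rfl, hU⟩
    _ = Group.rank (Subgroup.closure (T : Set G)) := hcard
    _ ≤ T.card := Subgroup.rank_closure_finset_le_card T

lemma mem_modKer_iff {π : Type*} [Group π] (φ : π →* Multiplicative ℤ) (n : ℕ) (x : π) :
    x ∈ modKer φ n ↔ (n : ℤ) ∣ (φ x).toAdd := by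
  exact CharP.intCast_eq_zero_iff (ZMod n) n (φ x).toAdd

/-- If `φ t` generates `nℤ`, then `π_n` is generated by `t` and generators of `ker φ`. -/
lemma closure_insert_eq_modKer {π : Type*} [Group π] (φ : π →* Multiplicative ℤ) (n : ℕ)
    {S : Set π} (hgen : Subgroup.closure S = φ.ker) {t : π}
    (ht : φ t = Multiplicative.ofAdd (n : ℤ)) :
    Subgroup.closure (insert t S) = modKer φ n := by
  apply le_antisymm
  · rw [Subgroup.closure_le]
    rintro x (rfl | hx)
    · simp [mem_modKer_iff, ht]
    · have hker : φ x = 1 := by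
        rw [← MonoidHom.mem_ker, ← hgen]
        exact Subgroup.subset_closure hx
      simp [mem_modKer_iff, hker]
  · intro x hx
    obtain ⟨m, hm⟩ := (mem_modKer_iff φ n x).1 hx
    have hker : x * (t ^ m)⁻¹ ∈ Subgroup.closure S := by
      rw [hgen, MonoidHom.mem_ker, map_mul, map_inv, map_zpow, ht, mul_inv_eq_one]
      apply Multiplicative.toAdd.injective
      simp [hm, mul_comm]
    have htm : t ^ m ∈ Subgroup.closure (insert t S) :=
      zpow_mem (Subgroup.subset_closure (Set.mem_insert t S)) m
    simpa using mul_mem (Subgroup.closure_mono (Set.subset_insert t S) hker) htm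

/-- If `φ : π → ℤ` is surjective and `ker φ` is generated by `k` elements, then
`rk(π_n) ≤ k + 1` for every positive `n`; in particular `rg(π, φ) = 0`. -/
theorem rank_modKer_le_of_ker_fg
    {π : Type*} [Group π] [Group.FG π] (φ : π →* Multiplicative ℤ)
    (hφ : Function.Surjective φ) (k : ℕ) (S : Finset π) (hcard : S.card ≤ k)
    (hgen : Subgroup.closure (S : Set π) = φ.ker) :
    (∀ n : ℕ, 0 < n → rk ↥(modKer φ n) ≤ k + 1) ∧ rankGradient φ = 0 := by
  classical
  have hrk : ∀ n : ℕ, rk ↥(modKer φ n) ≤ k + 1 := fun n ↦ by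
    obtain ⟨t, ht⟩ := hφ (Multiplicative.ofAdd (n : ℤ))
    have hT : Subgroup.closure ((insert t S : Finset π) : Set π) = modKer φ n := by
      rw [Finset.coe_insert, closure_insert_eq_modKer φ n hgen ht]
    exact (rk_le_card_of_closure_eq _ hT).trans <|
      (Finset.card_insert_le t S).trans (Nat.add_le_add_right hcard 1)
  refine ⟨fun n _ ↦ hrk n, Filter.Tendsto.liminf_eq ?_⟩
  refine squeeze_zero (fun n ↦ by positivity) (fun n ↦ ?_)
    (tendsto_const_div_atTop_nhds_zero_nat ((k + 1 : ℕ) : ℝ))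
  have := hrk n
  gcongr
end

section
/- Let A = ℤ[1/2] denote the additive group of dyadic rationals (rationals of the form a/2^m with a ∈ ℤ, m ∈ ℕ), let π := ℤ ⋉ A be the semidirect product in which k ∈ ℤ acts on A by multiplication by 2^k, and let φ: π → ℤ be the projection onto the ℤ-factor. Then φ is surjective, ker(φ) = A is not finitely generated, and for every positive integer n the subgroup π_n := ker(π → ℤ → ℤ/n) is generated by the two elements (n, 0) and (0, 1); in particular rk(π_n) ≤ 2 for all n. -/
/-- The additive group `A = ℤ[1/2]` of dyadic rationals, as an additive subgroup of `ℚ`. -/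
def dyadic : AddSubgroup ℚ where
  carrier := {q : ℚ | ∃ a : ℤ, ∃ m : ℕ, q = a / 2 ^ m}
  zero_mem' := ⟨0, 0, by norm_num⟩
  add_mem' := by
    rintro x y ⟨a, m, rfl⟩ ⟨b, l, rfl⟩
    refine ⟨a * 2 ^ l + b * 2 ^ m, m + l, ?_⟩
    have hm : (2 : ℚ) ^ m ≠ 0 := by positivity
    have hl : (2 : ℚ) ^ l ≠ 0 := by positivity
    push_cast
    rw [div_add_div _ _ hm hl, pow_add]
    ring_nf
  neg_mem' := by
    rintro x ⟨a, m, rfl⟩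
    exact ⟨-a, m, by push_cast; ring⟩

/-- Multiplication by `2` as an automorphism of `ℤ[1/2]`. -/
def double : dyadic ≃+ dyadic where
  toFun x := ⟨2 * x, by
    obtain ⟨a, m, h⟩ := x.2
    exact ⟨2 * a, m, by rw [h]; push_cast; ring⟩⟩
  invFun x := ⟨x / 2, by
    obtain ⟨a, m, h⟩ := x.2
    exact ⟨a, m + 1, by rw [h]; ring⟩⟩
  left_inv x := by ext; simp
  right_inv x := by ext; simp; ring
  map_add' x y := by ext; push_cast; ring

/-- The action of `ℤ` on `ℤ[1/2]` in which `k` acts by multiplication by `2^k`. -/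
def theta : Multiplicative ℤ →* MulAut (Multiplicative ↥dyadic) :=
  zpowersHom _ (AddEquiv.toMultiplicative double)

/-- The semidirect product `π = ℤ ⋉ ℤ[1/2]`. -/
abbrev DyadicSemidirect := SemidirectProduct (Multiplicative ↥dyadic) (Multiplicative ℤ) theta

/-- The projection `φ : ℤ ⋉ ℤ[1/2] → ℤ` onto the `ℤ`-factor. -/
def projZ : DyadicSemidirect →* Multiplicative ℤ := SemidirectProduct.rightHom

/-- The element `1 ∈ ℤ[1/2]`. -/
def oneDyadic : ↥dyadic := ⟨1, 1, 0, by norm_num⟩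

theorem rk_closure_le_card {G : Type*} [Group G] (S : Finset G) :
    rk ↥(Subgroup.closure (S : Set G)) ≤ S.card := by
  classical
  let T : Finset ↥(Subgroup.closure (S : Set G)) :=
    S.preimage Subtype.val Subtype.val_injective.injOn
  have hT : rk ↥(Subgroup.closure (S : Set G)) ≤ T.card :=
    Nat.sInf_le ⟨T, rfl, by
      rw [Finset.coe_preimage]
      exact Subgroup.closure_closure_coe_preimage⟩
  refine hT.trans ?_
  rw [Finset.card_preimage]
  exact Finset.card_filter_le _ _

theorem mem_modKer {π : Type*} [Group π] (φ : π →* Multiplicative ℤ) (n : ℕ) (g : π) :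
    g ∈ modKer φ n ↔ (n : ℤ) ∣ (φ g).toAdd := by
  rw [← ZMod.intCast_zmod_eq_zero_iff_dvd]
  exact MonoidHom.mem_ker

theorem coe_zpow_double_apply (k : ℤ) (x : dyadic) :
    ((((AddEquiv.toMultiplicative double : MulAut (Multiplicative dyadic)) ^ k)
      (Multiplicative.ofAdd x)).toAdd : ℚ) = 2 ^ k * x := by
  induction k generalizing x with
  | zero => simp
  | succ k ih =>
    rw [zpow_add_one, MulAut.mul_apply]
    refine (ih (double x)).trans ?_
    rw [zpow_add_one₀ two_ne_zero, mul_assoc]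
    rfl
  | pred k ih =>
    rw [zpow_sub_one, MulAut.mul_apply]
    refine (ih (double.symm x)).trans ?_
    rw [zpow_sub_one₀ two_ne_zero, mul_assoc]
    congr 1
    exact div_eq_inv_mul _ _

theorem coe_theta_apply (k : ℤ) (x : dyadic) :
    ((theta (Multiplicative.ofAdd k) (Multiplicative.ofAdd x)).toAdd : ℚ) = 2 ^ k * x :=
  coe_zpow_double_apply k x

theorem exists_ofAdd_eq_theta_zpow {n : ℕ} (hn : 0 < n) (x : dyadic) :
    ∃ (c : ℤ) (m : ℕ), Multiplicative.ofAdd x =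
      theta (Multiplicative.ofAdd (n : ℤ) ^ (-m : ℤ)) (Multiplicative.ofAdd oneDyadic) ^ c := by
  obtain ⟨a, m, h⟩ := x.2
  refine ⟨a * 2 ^ (n * m - m), m, ?_⟩
  apply Multiplicative.toAdd.injective
  apply Subtype.ext
  have key := coe_theta_apply ((-m : ℤ) * n) oneDyadic
  rw [← ofAdd_zsmul, toAdd_zpow, AddSubgroup.coe_zsmul, smul_eq_mul, key]
  have hm : m ≤ n * m := Nat.le_mul_of_pos_left m hn
  have hp : (2 : ℚ) ^ (n * m) = 2 ^ (n * m - m) * 2 ^ m := by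
    rw [← pow_add, Nat.sub_add_cancel hm]
  have hz : (2 : ℚ) ^ ((-m : ℤ) * n) = (2 ^ (n * m))⁻¹ := by
    rw [← zpow_natCast, ← zpow_neg]
    congr 1
    push_cast
    ring
  change (x : ℚ) = _
  rw [h, hz, hp, zsmul_eq_mul]
  simp only [oneDyadic]
  push_cast
  field_simp

theorem not_fg_dyadic : ¬ AddGroup.FG dyadic := by
  rintro ⟨S, hS⟩
  choose a m h using fun x : dyadic => x.2
  let M := S.sup m
  have hle : ∀ x : dyadic, ∃ c : ℤ, 2 ^ M * (x : ℚ) = c := by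
    intro x
    have hx : x ∈ AddSubgroup.closure (S : Set dyadic) := hS ▸ AddSubgroup.mem_top x
    induction hx using AddSubgroup.closure_induction with
    | mem x hx =>
      refine ⟨2 ^ (M - m x) * a x, ?_⟩
      have hp : (2 : ℚ) ^ M = 2 ^ (M - m x) * 2 ^ m x := by
        rw [← pow_add, Nat.sub_add_cancel (Finset.le_sup hx)]
      rw [h x, hp]
      push_cast
      field_simp
    | zero => exact ⟨0, by simp⟩
    | add x y _ _ hx hy =>
      obtain ⟨c, hc⟩ := hx
      obtain ⟨d, hd⟩ := hy
      exact ⟨c + d, by push_cast; rw [mul_add, hc, hd]⟩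
    | neg x _ hx =>
      obtain ⟨c, hc⟩ := hx
      exact ⟨-c, by push_cast; rw [mul_neg, hc]⟩
  obtain ⟨c, hc⟩ := hle ⟨1 / 2 ^ (M + 1), 1, M + 1, by simp⟩
  have h2 : (1 : ℚ) = 2 * c := by
    rw [← hc]
    simp only [pow_succ]
    field_simp
  have h3 : (1 : ℤ) = 2 * c := by exact_mod_cast h2
  omega

theorem ker_projZ : projZ.ker = SemidirectProduct.inl.range :=
  SemidirectProduct.range_inl_eq_ker_rightHom.symm

theorem not_fg_ker_projZ : ¬ projZ.ker.FG := by
  rw [ker_projZ, ← Group.fg_iff_subgroup_fg]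
  intro hfg
  have e := MonoidHom.ofInjective
    (SemidirectProduct.inl_injective (φ := theta))
  have : Group.FG (Multiplicative dyadic) :=
    Group.fg_of_surjective (f := e.symm.toMonoidHom) e.symm.surjective
  exact not_fg_dyadic (AddGroup.fg_iff_mul_fg.mpr this)

theorem modKer_projZ_eq_closure {n : ℕ} (hn : 0 < n) :
    modKer projZ n = Subgroup.closure
      {SemidirectProduct.inr (Multiplicative.ofAdd (n : ℤ)),
        SemidirectProduct.inl (Multiplicative.ofAdd oneDyadic)} := by
  apply le_antisymm
  · intro g hg
    obtain ⟨k, hk⟩ := (mem_modKer _ _ _).1 hg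
    set H := Subgroup.closure
      ({SemidirectProduct.inr (Multiplicative.ofAdd (n : ℤ)),
        SemidirectProduct.inl (Multiplicative.ofAdd oneDyadic)} : Set DyadicSemidirect)
    have ht : ∀ j : ℤ, SemidirectProduct.inr (Multiplicative.ofAdd (n : ℤ) ^ j) ∈ H := fun j => by
      rw [map_zpow]
      exact H.zpow_mem (Subgroup.subset_closure (by simp)) j
    have h1 : SemidirectProduct.inl (Multiplicative.ofAdd oneDyadic) ∈ H :=
      Subgroup.subset_closure (by simp)
    rw [← SemidirectProduct.inl_left_mul_inr_right g]
    refine H.mul_mem ?_ ?_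
    · obtain ⟨c, m, h⟩ := exists_ofAdd_eq_theta_zpow hn g.left.toAdd
      rw [ofAdd_toAdd] at h
      rw [h, map_zpow, SemidirectProduct.inl_aut, map_inv]
      exact H.zpow_mem (H.mul_mem (H.mul_mem (ht _) h1) (H.inv_mem (ht _))) c
    · have hr : g.right = Multiplicative.ofAdd (n : ℤ) ^ k := by
        rw [← ofAdd_zsmul, smul_eq_mul, mul_comm, ← hk]
        rfl
      rw [hr]
      exact ht k
  · rw [Subgroup.closure_le]
    rintro _ (rfl | rfl)
    · exact (mem_modKer _ _ _).2 (dvd_refl (n : ℤ))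
    · exact (mem_modKer _ _ _).2 (dvd_zero (n : ℤ))

/-- For `π = ℤ ⋉ ℤ[1/2]` (with `k ∈ ℤ` acting by multiplication by `2^k`) and
`φ : π → ℤ` the projection: `φ` is surjective, `ker φ = ℤ[1/2]` is not finitely
generated, and for every positive `n` the subgroup `π_n = ker(π → ℤ → ℤ/n)` is
generated by the two elements `(n, 0)` and `(0, 1)`; in particular `rk(π_n) ≤ 2`. -/
theorem dyadic_semidirect_rank_two :
    Function.Surjective projZ ∧
    projZ.ker = SemidirectProduct.inl.range ∧
    ¬ projZ.ker.FG ∧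
    ∀ n : ℕ, 0 < n →
      modKer projZ n = Subgroup.closure
        {SemidirectProduct.inr (Multiplicative.ofAdd (n : ℤ)),
         SemidirectProduct.inl (Multiplicative.ofAdd oneDyadic)} ∧
      rk ↥(modKer projZ n) ≤ 2 := by
  refine ⟨SemidirectProduct.rightHom_surjective, ker_projZ, not_fg_ker_projZ, fun n hn =>
    ⟨modKer_projZ_eq_closure hn, ?_⟩⟩
  classical
  rw [modKer_projZ_eq_closure hn]
  have h := rk_closure_le_card
    ({SemidirectProduct.inr (Multiplicative.ofAdd (n : ℤ)),
      SemidirectProduct.inl (Multiplicative.ofAdd oneDyadic)} : Finset DyadicSemidirect)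
  rw [Finset.coe_pair] at h
  exact h.trans Finset.card_le_two
end
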